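/- Let f be a meromorphic function on the tube domain 𝒯_B that is distinguished with respect to (V; c; l_1, …, l_m), and let C be a connected component of B \ ∪_{j=1}^m ker(l_j). Then there exist an open convex neighborhood B̃ of 0 in E containing C and real linear forms l̃_1, …, l̃_{m̃} on E, each vanishing identically on V, such that the function z ↦ f̃_C(z) · ∏_{j=1}^{m̃} l̃_j(z) has a holomorphic continuation to the tube domain 𝒯_{B̃}; moreover, for each j one has ker(l̃_j) ∩ C = ∅. -/

import Mathlib

/-!
Setup: `E = ℝ^n`, `E_ℂ = ℂ^n`; linearly independent real linear forms
`l_1, …, l_m` on `E` given by their coefficient vectors `l j : Fin n → ℝ`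
(extended ℂ-linearly); a subspace `V ⊆ E` of dimension `ν` with a Lebesgue
measure, realized as the range of an injective linear map
`ι : ℝ^ν → ℝ^n` carrying the standard Lebesgue measure of `ℝ^ν`; an open
convex neighborhood `B` of `0` with `l_j > -1` on `B`; tube domains,
sufficient functions, distinguished functions, and
`f̃_C(z) = (2π)^{-ν} ∫_V f(z+iv) dv`.
-/

open MeasureTheory Filter
open scoped BigOperators

/-- The real linear form on `ℝ^n` with coefficient vector `a`. -/
noncomputable def lR {n : ℕ} (a : Fin n → ℝ) (x : Fin n → ℝ) : ℝ :=
  ∑ k, a k * x k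

/-- The ℂ-linear extension to `ℂ^n` of the real linear form with coefficient
vector `a`. -/
noncomputable def lC {n : ℕ} (a : Fin n → ℝ) (z : Fin n → ℂ) : ℂ :=
  ∑ k, (a k : ℂ) * z k

/-- The tube domain over a set `B ⊆ ℝ^n`: all `z ∈ ℂ^n` with `Re z ∈ B`. -/
def tube {n : ℕ} (B : Set (Fin n → ℝ)) : Set (Fin n → ℂ) :=
  {z | (fun k => (z k).re) ∈ B}

/-- `z + i·x`, for `z ∈ ℂ^n` and `x ∈ ℝ^n`. -/
noncomputable def addI {n : ℕ} (z : Fin n → ℂ) (x : Fin n → ℝ) : Fin n → ℂ :=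
  fun k => z k + Complex.I * (x k : ℂ)

/-- A *sufficient* function on `V` (in the fixed coordinates `V ≅ ℝ^ν`):
for every subspace `U ⊆ V` (realized as the range of an injective linear map
`u : ℝ^k → ℝ^ν`, carrying a Lebesgue measure) and every `v`, the function
`u ↦ c(v+u)` is measurable with finite integral `c_U(v)`, and for `v ∉ U`,
`c_U(τ v) → 0` as `τ → ±∞`. -/
def Sufficient {ν : ℕ} (c : (Fin ν → ℝ) → ℝ) : Prop :=
  ∀ (k : ℕ) (u : (Fin k → ℝ) →ₗ[ℝ] (Fin ν → ℝ)), Function.Injective u →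
    (∀ v : Fin ν → ℝ, Measurable (fun w : Fin k → ℝ => c (v + u w)) ∧
      Integrable (fun w : Fin k → ℝ => c (v + u w))) ∧
    (∀ v : Fin ν → ℝ, v ∉ LinearMap.range u →
      Tendsto (fun τ : ℝ => ∫ w : Fin k → ℝ, c (τ • v + u w)) atTop (nhds 0) ∧
      Tendsto (fun τ : ℝ => ∫ w : Fin k → ℝ, c (τ • v + u w)) atBot (nhds 0))

/-- `f` is a meromorphic function on the tube domain `𝒯_B` which is
*distinguished* with respect to `(V; c; l_1, …, l_m)`, with associated
holomorphic function `g(z) = f(z) ∏_j l_j(z)/(l_j(z)+1)` on `𝒯_B`.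
Here `V = range ι` with its Lebesgue measure. -/
structure Distinguished {n ν m : ℕ} (f g : (Fin n → ℂ) → ℂ)
    (B : Set (Fin n → ℝ)) (l : Fin m → (Fin n → ℝ))
    (ι : (Fin ν → ℝ) →ₗ[ℝ] (Fin n → ℝ)) (c : (Fin ν → ℝ) → ℝ) : Prop where
  hB_open : IsOpen B
  hB_convex : Convex ℝ B
  hB_zero : (0 : Fin n → ℝ) ∈ B
  hB_l : ∀ x ∈ B, ∀ j, -1 < lR (l j) x
  hl_indep : LinearIndependent ℝ l
  hι_inj : Function.Injective ι
  hg_holo : DifferentiableOn ℂ g (tube B)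
  hfg : ∀ z ∈ tube B, (∀ j, lC (l j) z ≠ 0) →
    g z = f z * ∏ j, lC (l j) z / (lC (l j) z + 1)
  hc_nonneg : ∀ v, 0 ≤ c v
  hc_suff : Sufficient c
  hbound : ∀ K : Set (Fin n → ℂ), K ⊆ tube B → IsCompact K →
    ∃ κ > (0 : ℝ), ∀ z ∈ K, ∀ v : Fin ν → ℝ, ‖g (addI z (ι v))‖ ≤ κ * c v

/-- `f̃(z) = (2π)^{-ν} ∫_V f(z + iv) dv`, where `V = range ι` with the
Lebesgue measure transported from `ℝ^ν`. -/
noncomputable def ftil {n ν : ℕ} (f : (Fin n → ℂ) → ℂ)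
    (ι : (Fin ν → ℝ) →ₗ[ℝ] (Fin n → ℝ)) (z : Fin n → ℂ) : ℂ :=
  ((2 * Real.pi : ℂ) ^ ν)⁻¹ * ∫ v : Fin ν → ℝ, f (addI z (ι v))

lemma tube_isOpen {n : ℕ} {D : Set (Fin n → ℝ)} (hD : IsOpen D) : IsOpen (tube D) := by
  have : Continuous (fun z : Fin n → ℂ => fun k => (z k).re) := by fun_prop
  exact hD.preimage this

lemma addI_mem_tube {n : ℕ} {D : Set (Fin n → ℝ)} {z : Fin n → ℂ} (x : Fin n → ℝ) :
    addI z x ∈ tube D ↔ z ∈ tube D := by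
  simp [tube, addI]

lemma lR_add {n : ℕ} (a x y : Fin n → ℝ) : lR a (x + y) = lR a x + lR a y := by
  simp [lR, mul_add, Finset.sum_add_distrib]

lemma lR_smul {n : ℕ} (a x : Fin n → ℝ) (t : ℝ) : lR a (t • x) = t * lR a x := by
  simp only [lR, Pi.smul_apply, smul_eq_mul, Finset.mul_sum]
  exact Finset.sum_congr rfl fun _ _ => by ring

lemma lR_continuous {n : ℕ} (a : Fin n → ℝ) : Continuous (lR a) := by
  unfold lR; fun_prop

lemma lC_re {n : ℕ} (a : Fin n → ℝ) (z : Fin n → ℂ) :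
    (lC a z).re = lR a (fun k => (z k).re) := by
  simp [lC, lR]

lemma lC_addI {n : ℕ} (a : Fin n → ℝ) (z : Fin n → ℂ) (x : Fin n → ℝ) :
    lC a (addI z x) = lC a z + Complex.I * (lR a x : ℂ) := by
  simp only [lC, addI, lR, mul_add, Finset.sum_add_distrib, Complex.ofReal_sum, Finset.mul_sum,
    Complex.ofReal_mul]
  congr 1
  exact Finset.sum_congr rfl fun _ _ => by ring

lemma lC_differentiable {n : ℕ} (a : Fin n → ℝ) : Differentiable ℂ (lC a) := by
  unfold lC; fun_prop

/-- The local domination hypothesis. -/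
def Dom {n ν : ℕ} (h : (Fin n → ℂ) → ℂ) (D : Set (Fin n → ℝ))
    (ι : (Fin ν → ℝ) →ₗ[ℝ] (Fin n → ℝ)) (c : (Fin ν → ℝ) → ℝ) : Prop :=
  ∀ K : Set (Fin n → ℂ), K ⊆ tube D → IsCompact K →
    ∃ κ : ℝ, ∀ z ∈ K, ∀ v : Fin ν → ℝ, ‖h (addI z (ι v))‖ ≤ κ * c v

lemma addI_continuous {n ν : ℕ} (ι : (Fin ν → ℝ) →ₗ[ℝ] (Fin n → ℝ)) (z : Fin n → ℂ) :
    Continuous (fun v => addI z (ι v)) := by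
  have : Continuous ι := ι.continuous_of_finiteDimensional
  unfold addI; fun_prop

lemma addI_eq {n : ℕ} (z : Fin n → ℂ) (x : Fin n → ℝ) :
    addI z x = z + (fun k => Complex.I * (x k : ℂ)) := rfl

section
variable {n ν : ℕ} {h : (Fin n → ℂ) → ℂ} {D : Set (Fin n → ℝ)}
    {ι : (Fin ν → ℝ) →ₗ[ℝ] (Fin n → ℝ)} {c : (Fin ν → ℝ) → ℝ}

lemma meas_aux (hD : IsOpen D) (hh : DifferentiableOn ℂ h (tube D))
    {z : Fin n → ℂ} (hz : z ∈ tube D) : Continuous (fun v => h (addI z (ι v))) := by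
  rw [continuous_iff_continuousAt]
  intro v
  have h1 : ContinuousAt h (addI z (ι v)) :=
    (hh.differentiableAt ((tube_isOpen hD).mem_nhds ((addI_mem_tube _).2 hz))).continuousAt
  exact h1.comp (f := fun v => addI z (ι v)) (addI_continuous ι z).continuousAt

lemma int_aux (hD : IsOpen D) (hh : DifferentiableOn ℂ h (tube D)) (hd : Dom h D ι c)
    (hc : Integrable c) {z : Fin n → ℂ} (hz : z ∈ tube D) :
    Integrable (fun v => h (addI z (ι v))) := by
  obtain ⟨κ, hκ⟩ := hd {z} (by simpa using hz) isCompact_singleton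
  refine (hc.const_mul κ).mono' (meas_aux hD hh hz).aestronglyMeasurable ?_
  exact Eventually.of_forall fun v => hκ z rfl v

lemma diff_aux (hD : IsOpen D) (hh : DifferentiableOn ℂ h (tube D)) (hd : Dom h D ι c)
    (hc : Integrable c) :
    DifferentiableOn ℂ (fun z => ∫ v, h (addI z (ι v))) (tube D) := by
  intro z₀ hz₀
  obtain ⟨r, hr, hrD⟩ := Metric.nhds_basis_closedBall.mem_iff.1 ((tube_isOpen hD).mem_nhds hz₀)
  obtain ⟨κ, hκ⟩ := hd _ hrD (isCompact_closedBall z₀ r)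
  have hsub : ∀ z ∈ Metric.ball z₀ r, z ∈ tube D := fun z hz =>
    hrD (Metric.ball_subset_closedBall hz)
  have hdz : ∀ v, ∀ z ∈ tube D, HasFDerivAt (fun z => h (addI z (ι v)))
      (fderiv ℂ h (addI z (ι v))) z := by
    intro v z hz
    have h1 := (hh.differentiableAt
      ((tube_isOpen hD).mem_nhds ((addI_mem_tube (ι v)).2 hz))).hasFDerivAt
    have h2 : HasFDerivAt (fun z => addI z (ι v)) (ContinuousLinearMap.id ℂ (Fin n → ℂ)) z :=
      (hasFDerivAt_id z).add_const (fun k => Complex.I * ((ι v) k : ℂ))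
    exact h1.comp (f := fun z => addI z (ι v)) z h2
  have key := hasFDerivAt_integral_of_dominated_loc_of_lip' (𝕜 := ℂ) (μ := volume)
    (F := fun z v => h (addI z (ι v))) (x₀ := z₀) (s := Metric.ball z₀ r)
    (bound := fun v => (2 * (κ * c v)) / r)
    (F' := fun v => fderiv ℂ h (addI z₀ (ι v)))
    (Metric.ball_mem_nhds _ hr)
    (fun z hz => (meas_aux hD hh (hsub z hz)).aestronglyMeasurable)
    (int_aux hD hh hd hc hz₀)
    (((measurable_fderiv ℂ h).comp (addI_continuous ι z₀).measurable).aestronglyMeasurable)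
    ?_ (((hc.const_mul κ).const_mul 2).div_const r)
    (Eventually.of_forall fun v => hdz v z₀ hz₀)
  · exact key.2.differentiableAt.differentiableWithinAt
  · refine Eventually.of_forall fun v z hz => ?_
    have := Complex.dist_le_div_mul_dist_of_mapsTo_ball (f := fun z => h (addI z (ι v)))
      (c := z₀) (R₁ := r) (R₂ := 2 * (κ * c v)) (z := z)
      (fun w hw => (hdz v w (hsub w hw)).differentiableAt.differentiableWithinAt) ?_ hz
    · simpa [dist_eq_norm] using this
    · intro w hw
      have h1 := hκ w (Metric.ball_subset_closedBall hw) v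
      have h2 := hκ z₀ (Metric.mem_closedBall_self hr.le) v
      rw [Metric.mem_closedBall, dist_eq_norm]
      exact (norm_sub_le _ _).trans (by linarith)

lemma shiftI_aux (z : Fin n → ℂ) (w : Fin ν → ℝ) :
    ∫ v, h (addI (addI z (ι w)) (ι v)) = ∫ v, h (addI z (ι v)) := by
  rw [← integral_add_left_eq_self (fun v => h (addI z (ι v))) w]
  congr 1
  ext v
  congr 1
  ext k
  simp [addI]
  ring

/-- real shift -/
noncomputable def sh {n : ℕ} (z : Fin n → ℂ) (s : ℂ) (x : Fin n → ℝ) : Fin n → ℂ :=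
  fun k => z k + s * (x k : ℂ)

lemma const_aux (hD : IsOpen D) (hDc : Convex ℝ D) {H : (Fin n → ℂ) → ℂ}
    (hH : DifferentiableOn ℂ H (tube D)) (x : Fin n → ℝ)
    (hinv : ∀ z, ∀ y : ℝ, H (addI z (y • x)) = H z)
    {z : Fin n → ℂ} {t : ℝ} (hz : z ∈ tube D) (ht : sh z t x ∈ tube D) :
    H (sh z t x) = H z := by
  set S : Set ℂ := {s | sh z s x ∈ tube D} with hS
  have hmem : ∀ s, s ∈ S ↔ (fun k => (z k).re) + s.re • x ∈ D := by
    intro s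
    have : (fun k => (sh z s x k).re) = (fun k => (z k).re) + s.re • x := by
      ext k; simp [sh]
    rw [hS, Set.mem_ofPred_eq, tube, Set.mem_ofPred_eq, this]
  have hcont : Continuous (fun s => sh z s x) := by unfold sh; fun_prop
  have hSo : IsOpen S := (tube_isOpen hD).preimage hcont
  have hSc : Convex ℝ S := by
    intro a ha b hb p q hp hq hpq
    rw [hmem] at *
    convert hDc ha hb hp hq hpq using 1
    ext k
    have : (p + q) * (z k).re = (z k).re := by rw [hpq, one_mul]
    simp
    linear_combination -this
  have hdiff : DifferentiableOn ℂ (fun s => H (sh z s x)) S := by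
    intro s hs
    have h1 := hH.differentiableAt ((tube_isOpen hD).mem_nhds hs)
    have h2 : DifferentiableAt ℂ (fun s => sh z s x) s := by unfold sh; fun_prop
    exact (h1.comp (f := fun s => sh z s x) s h2).differentiableWithinAt
  have hder : ∀ s ∈ S, deriv (fun s => H (sh z s x)) s = 0 := by
    intro s hs
    have h1 := (hdiff.differentiableAt (hSo.mem_nhds hs)).hasDerivAt
    have h2 : HasDerivAt (fun y : ℝ => s + Complex.I * (y : ℂ)) Complex.I 0 := by
      simpa using ((Complex.ofRealCLM.hasDerivAt (x := (0:ℝ))).const_mul Complex.I).const_add s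
    have h3 := HasDerivAt.comp_of_eq (0:ℝ) h1 h2 (by simp)
    have h4 : (fun s => H (sh z s x)) ∘ (fun y : ℝ => s + Complex.I * (y : ℂ))
        = fun _ => H (sh z s x) := by
      ext y
      rw [← hinv (sh z s x) y]
      simp only [Function.comp]
      congr 1
      ext k
      simp [sh, addI]
      ring
    rw [h4] at h3
    have := h3.unique (hasDerivAt_const _ _)
    simpa using this
  have h0 : (0:ℂ) ∈ S := by
    rw [hmem]; simpa [tube] using hz
  have := hSo.is_const_of_deriv_eq_zero hSc.isPreconnected hdiff hder ht h0
  have e : sh z 0 x = z := by ext k; simp [sh]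
  simpa [e] using this

/-- Extension along a real direction. -/
lemma extend_aux (hD : IsOpen D) (hDc : Convex ℝ D) {H : (Fin n → ℂ) → ℂ}
    (hH : DifferentiableOn ℂ H (tube D)) (x : Fin n → ℝ)
    (hinv : ∀ z, ∀ y : ℝ, H (addI z (y • x)) = H z) (t₀ : ℝ) (h0 : t₀ • x ∈ D) :
    ∃ B : Set (Fin n → ℝ), IsOpen B ∧ Convex ℝ B ∧ (0 : Fin n → ℝ) ∈ B ∧ D ⊆ B ∧
      ∃ G : (Fin n → ℂ) → ℂ, DifferentiableOn ℂ G (tube B) ∧ ∀ z ∈ tube D, G z = H z := by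
  classical
  let B : Set (Fin n → ℝ) := {y | ∃ t : ℝ, y + t • x ∈ D}
  have hsh : ∀ (z : Fin n → ℂ) (t : ℝ), sh z t x ∈ tube D ↔ (fun k => (z k).re) + t • x ∈ D := by
    intro z t
    have : (fun k => (sh z t x k).re) = (fun k => (z k).re) + t • x := by
      ext k; simp [sh]
    rw [tube, Set.mem_ofPred_eq, this]
  have huniq : ∀ (z : Fin n → ℂ) (t s : ℝ), sh z t x ∈ tube D → sh z s x ∈ tube D →
      H (sh z t x) = H (sh z s x) := by
    intro z t s ht hs
    have e : sh (sh z s x) ((t - s : ℝ) : ℂ) x = sh z t x := by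
      ext k; simp [sh]; ring
    rw [← e]
    exact const_aux hD hDc hH x hinv hs (by rw [e]; exact ht)
  refine ⟨B, ?_, ?_, ⟨t₀, by simpa using h0⟩, fun y hy => ⟨0, by simpa using hy⟩, ?_⟩
  · have : B = ⋃ t : ℝ, (fun y => y + t • x) ⁻¹' D := by ext; simp [B]
    rw [this]
    exact isOpen_iUnion fun t => hD.preimage (by fun_prop)
  · rintro a ⟨s, hs⟩ b ⟨t, ht⟩ p q hp hq hpq
    refine ⟨p * s + q * t, ?_⟩
    convert hDc hs ht hp hq hpq using 1
    ext k; simp; ring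
  · let G : (Fin n → ℂ) → ℂ := fun z =>
      if hz : ∃ t : ℝ, sh z t x ∈ tube D then H (sh z hz.choose x) else 0
    have hG : ∀ z, ∀ t : ℝ, sh z t x ∈ tube D → G z = H (sh z t x) := by
      intro z t ht
      have hz : ∃ t : ℝ, sh z t x ∈ tube D := ⟨t, ht⟩
      simp only [G, dif_pos hz]
      exact huniq _ _ _ hz.choose_spec ht
    refine ⟨G, ?_, ?_⟩
    · rintro z ⟨t, ht⟩
      rw [← hsh] at ht
      have hc : Continuous (fun z => sh z t x) := by unfold sh; fun_prop
      have hev : G =ᶠ[nhds z] fun z => H (sh z t x) := by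
        filter_upwards [((tube_isOpen hD).preimage hc).mem_nhds ht] with w hw
        exact hG w t hw
      have h1 := hH.differentiableAt ((tube_isOpen hD).mem_nhds ht)
      have h2 : DifferentiableAt ℂ (fun z => sh z t x) z := by unfold sh; fun_prop
      exact ((h1.comp (f := fun z => sh z t x) z h2).congr_of_eventuallyEq
        hev).differentiableWithinAt
    · intro z hz
      have e : sh z ((0:ℝ):ℂ) x = z := by ext k; simp [sh]
      rw [hG z 0 (by rw [e]; exact hz), e]
end

/-- Gordan's alternative. -/
lemma gordan {ν : ℕ} {κ : Type*} (J : Finset κ) (a : κ → Fin ν → ℝ) :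
    (∃ w : Fin ν → ℝ, ∀ j ∈ J, 0 < ∑ k, a j k * w k) ∨
    (∃ r : κ → ℝ, (∀ j ∈ J, 0 ≤ r j) ∧ (∃ j ∈ J, 0 < r j) ∧ ∑ j ∈ J, r j • a j = 0) := by
  classical
  by_cases h0 : (0 : Fin ν → ℝ) ∈ convexHull ℝ ((J.image a : Finset _) : Set (Fin ν → ℝ))
  · right
    rw [mem_convexHull_iff_exists_fintype] at h0
    obtain ⟨T, _, w, z, hw0, hw1, hz, hs⟩ := h0
    have hz' : ∀ i, ∃ j ∈ J, a j = z i := by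
      intro i; simpa using hz i
    choose p hpJ hp using hz'
    have hr0 : ∀ j, 0 ≤ ∑ i with p i = j, w i := fun j => Finset.sum_nonneg fun i _ => hw0 i
    refine ⟨fun j => ∑ i with p i = j, w i, fun j _ => hr0 j, ?_, ?_⟩
    · by_contra hcon
      push Not at hcon
      have h1 : ∑ j ∈ J, ∑ i with p i = j, w i = ∑ i, w i :=
        Finset.sum_fiberwise_of_maps_to (fun i _ => hpJ i) w
      have h2 : ∑ j ∈ J, ∑ i with p i = j, w i ≤ 0 := Finset.sum_nonpos hcon
      linarith
    · rw [← hs, ← Finset.sum_fiberwise_of_maps_to (t := J) (g := p) (fun i _ => hpJ i)]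
      refine Finset.sum_congr rfl fun j _ => ?_
      rw [Finset.sum_smul]
      refine Finset.sum_congr rfl fun i hi => ?_
      rw [← hp i, (Finset.mem_filter.1 hi).2]
  · left
    obtain ⟨f, u, hu, hf⟩ := geometric_hahn_banach_point_closed (convex_convexHull ℝ _)
      ((Finset.finite_toSet _).isClosed_convexHull ℝ) h0
    refine ⟨fun k => f (Pi.single k 1), fun j hj => ?_⟩
    have h1 : f (a j) = ∑ k, a j k * f (Pi.single k 1) := by
      conv_lhs => rw [pi_eq_sum_univ' (a j), map_sum]
      simp
    rw [← h1]
    have := hf (a j) (subset_convexHull ℝ _ (by simpa using ⟨j, hj, rfl⟩))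
    simp at hu
    linarith

/-- The conclusion of the theorem for a function `F`. -/
def HolExt {n ν : ℕ} (ι : (Fin ν → ℝ) →ₗ[ℝ] (Fin n → ℝ)) (C : Set (Fin n → ℝ))
    (F : (Fin n → ℂ) → ℂ) : Prop :=
  ∃ B : Set (Fin n → ℝ), IsOpen B ∧ Convex ℝ B ∧ (0 : Fin n → ℝ) ∈ B ∧ C ⊆ B ∧
    ∃ L : List (Fin n → ℝ), (∀ a ∈ L, (∀ w, lR a (ι w) = 0) ∧ ∀ x ∈ C, lR a x ≠ 0) ∧
      ∃ G : (Fin n → ℂ) → ℂ, DifferentiableOn ℂ G (tube B) ∧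
        ∀ z ∈ tube C, G z = F z * (L.map (fun a => lC a z)).prod

lemma listprod_diff {n : ℕ} (L : List (Fin n → ℝ)) :
    Differentiable ℂ (fun z => (L.map (fun a => lC a z)).prod) := by
  induction L with
  | nil => simp
  | cons a L ih =>
    simp only [List.map_cons, List.prod_cons]
    exact (lC_differentiable a).mul ih

section
variable {n ν : ℕ} {ι : (Fin ν → ℝ) →ₗ[ℝ] (Fin n → ℝ)} {C : Set (Fin n → ℝ)}

lemma HolExt.congr {F F' : (Fin n → ℂ) → ℂ} (h : HolExt ι C F) (e : ∀ z ∈ tube C, F' z = F z) :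
    HolExt ι C F' := by
  obtain ⟨B, h1, h2, h3, h4, L, hL, G, hG, hG'⟩ := h
  exact ⟨B, h1, h2, h3, h4, L, hL, G, hG, fun z hz => by rw [hG' z hz, e z hz]⟩

lemma HolExt.zero : HolExt ι C (fun _ => 0) :=
  ⟨Set.univ, isOpen_univ, convex_univ, trivial, Set.subset_univ _, [], by simp,
    fun _ => 0, differentiableOn_const _, by simp⟩

lemma HolExt.add {F F' : (Fin n → ℂ) → ℂ} (h : HolExt ι C F) (h' : HolExt ι C F') :
    HolExt ι C (fun z => F z + F' z) := by
  obtain ⟨B, h1, h2, h3, h4, L, hL, G, hG, hG'⟩ := h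
  obtain ⟨B', h1', h2', h3', h4', L', hL', G', hGG, hGG'⟩ := h'
  refine ⟨B ∩ B', h1.inter h1', h2.inter h2', ⟨h3, h3'⟩, Set.subset_inter h4 h4', L ++ L', ?_,
    fun z => G z * (L'.map (fun a => lC a z)).prod + G' z * (L.map (fun a => lC a z)).prod, ?_, ?_⟩
  · intro a ha
    rcases List.mem_append.1 ha with ha | ha
    · exact hL a ha
    · exact hL' a ha
  · have s1 : tube (B ∩ B') ⊆ tube B := fun z hz => hz.1
    have s2 : tube (B ∩ B') ⊆ tube B' := fun z hz => hz.2
    exact ((hG.mono s1).mul (listprod_diff L').differentiableOn).add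
      ((hGG.mono s2).mul (listprod_diff L).differentiableOn)
  · intro z hz
    simp only [hG' z hz, hGG' z hz, List.map_append, List.prod_append]
    ring

lemma HolExt.smul {F : (Fin n → ℂ) → ℂ} (h : HolExt ι C F) (r : ℂ) :
    HolExt ι C (fun z => r * F z) := by
  obtain ⟨B, h1, h2, h3, h4, L, hL, G, hG, hG'⟩ := h
  exact ⟨B, h1, h2, h3, h4, L, hL, fun z => r * G z, hG.const_mul r,
    fun z hz => by simp only [hG' z hz, mul_assoc]⟩

lemma HolExt.sum {T : Type*} (S : Finset T) (F : T → (Fin n → ℂ) → ℂ)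
    (h : ∀ i ∈ S, HolExt ι C (F i)) : HolExt ι C (fun z => ∑ i ∈ S, F i z) := by
  classical
  induction S using Finset.induction_on with
  | empty => simpa using HolExt.zero
  | insert a S ha ih =>
    simp only [Finset.sum_insert ha]
    exact (h a (by simp)).add (ih fun i hi => h i (by simp [hi]))

lemma HolExt.of_mul {F : (Fin n → ℂ) → ℂ} {a : Fin n → ℝ} (ha : ∀ w, lR a (ι w) = 0)
    (haC : ∀ x ∈ C, lR a x ≠ 0) (h : HolExt ι C (fun z => lC a z * F z)) : HolExt ι C F := by
  obtain ⟨B, h1, h2, h3, h4, L, hL, G, hG, hG'⟩ := h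
  refine ⟨B, h1, h2, h3, h4, a :: L, ?_, G, hG, fun z hz => ?_⟩
  · intro b hb
    rcases List.mem_cons.1 hb with rfl | hb
    · exact ⟨ha, haC⟩
    · exact hL b hb
  · rw [hG' z hz]; simp only [List.map_cons, List.prod_cons]; ring
end

/-- The integrand for a subset `J`. -/
noncomputable def hJ {n m : ℕ} (g : (Fin n → ℂ) → ℂ) (l : Fin m → (Fin n → ℝ))
    (J : Finset (Fin m)) (z : Fin n → ℂ) : ℂ := g z * ∏ j ∈ J, (lC (l j) z)⁻¹

/-- The sign region for a subset `J`. -/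
def DJ {n m : ℕ} (B : Set (Fin n → ℝ)) (l : Fin m → (Fin n → ℝ)) (σ : Fin m → ℝ)
    (J : Finset (Fin m)) : Set (Fin n → ℝ) := {x | x ∈ B ∧ ∀ j ∈ J, 0 < σ j * lR (l j) x}

section
variable {n ν m : ℕ} {f g : (Fin n → ℂ) → ℂ} {B : Set (Fin n → ℝ)} {l : Fin m → (Fin n → ℝ)}
  {ι : (Fin ν → ℝ) →ₗ[ℝ] (Fin n → ℝ)} {c : (Fin ν → ℝ) → ℝ}

lemma DJ_open (hB : IsOpen B) (σ : Fin m → ℝ) (J : Finset (Fin m)) : IsOpen (DJ B l σ J) := by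
  have : DJ B l σ J = B ∩ ⋂ j ∈ J, {x | 0 < σ j * lR (l j) x} := by
    ext x; simp [DJ]
  rw [this]
  exact hB.inter (isOpen_biInter_finset fun j _ =>
    isOpen_lt continuous_const (continuous_const.mul (lR_continuous _)))

lemma DJ_convex (hB : Convex ℝ B) (σ : Fin m → ℝ) (J : Finset (Fin m)) :
    Convex ℝ (DJ B l σ J) := by
  intro x hx y hy p q hp hq hpq
  refine ⟨hB hx.1 hy.1 hp hq hpq, fun j hj => ?_⟩
  have h := (convex_Ioi (0:ℝ)) (hx.2 j hj) (hy.2 j hj) hp hq hpq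
  rw [lR_add, lR_smul, lR_smul]
  simp only [smul_eq_mul, Set.mem_Ioi] at h
  linarith

lemma lC_ne {σ : Fin m → ℝ} {J : Finset (Fin m)} {z : Fin n → ℂ} (hz : z ∈ tube (DJ B l σ J))
    {j : Fin m} (hj : j ∈ J) : lC (l j) z ≠ 0 := by
  intro h0
  have h1 := hz.2 j hj
  rw [← lC_re, h0] at h1
  simp at h1

lemma hJ_diff (hd : Distinguished f g B l ι c) (σ : Fin m → ℝ) (J : Finset (Fin m)) :
    DifferentiableOn ℂ (hJ g l J) (tube (DJ B l σ J)) := by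
  unfold hJ
  have h1 : DifferentiableOn ℂ g (tube (DJ B l σ J)) := hd.hg_holo.mono fun z hz => hz.1
  refine h1.mul ?_
  have key : ∀ S : Finset (Fin m), S ⊆ J →
      DifferentiableOn ℂ (fun z => ∏ j ∈ S, (lC (l j) z)⁻¹) (tube (DJ B l σ J)) := by
    classical
    intro S
    induction S using Finset.induction_on with
    | empty => intro _; simp
    | insert a S ha ih =>
      intro hS
      simp only [Finset.prod_insert ha]
      exact ((lC_differentiable (l a)).differentiableOn.inv
        fun z hz => lC_ne hz (hS (Finset.mem_insert_self a S))).mul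
        (ih ((Finset.subset_insert a S).trans hS))
  exact key J (Finset.Subset.refl J)

lemma hJ_dom (hd : Distinguished f g B l ι c) (σ : Fin m → ℝ) (J : Finset (Fin m)) :
    Dom (hJ g l J) (DJ B l σ J) ι c := by
  intro K hK hKc
  obtain ⟨κ, hκ, hb⟩ := hd.hbound K (fun z hz => (hK hz).1) hKc
  have hcont : ContinuousOn (fun z : Fin n → ℂ => ∏ j ∈ J, |lR (l j) (fun k => (z k).re)|⁻¹) K := by
    refine continuousOn_finsetProd J fun j hj => ?_
    refine ContinuousOn.inv₀ ?_ ?_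
    · have : Continuous (fun z : Fin n → ℂ => fun k => (z k).re) := by fun_prop
      exact ((lR_continuous (l j)).comp this).abs.continuousOn
    · intro z hz
      have := (hK hz).2 j hj
      exact abs_ne_zero.2 (right_ne_zero_of_mul this.ne')
  obtain ⟨M, hM⟩ := (hKc.image_of_continuousOn hcont).bddAbove
  refine ⟨κ * M, fun z hz v => ?_⟩
  have hM' := hM ⟨z, hz, rfl⟩
  have h2 : ‖∏ j ∈ J, (lC (l j) (addI z (ι v)))⁻¹‖
      ≤ ∏ j ∈ J, |lR (l j) (fun k => (z k).re)|⁻¹ := by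
    rw [norm_prod]
    refine Finset.prod_le_prod (fun _ _ => norm_nonneg _) fun j hj => ?_
    rw [norm_inv]
    have hne := (hK hz).2 j hj
    have hpos : 0 < |lR (l j) (fun k => (z k).re)| := abs_pos.2 (right_ne_zero_of_mul hne.ne')
    refine inv_anti₀ hpos ?_
    have := Complex.abs_re_le_norm (lC (l j) (addI z (ι v)))
    rw [lC_re] at this
    simpa [addI] using this
  have h3 := hb z hz v
  unfold hJ
  rw [norm_mul]
  calc _ ≤ (κ * c v) * M := mul_le_mul h3 (h2.trans hM') (norm_nonneg _) 
        (mul_nonneg hκ.le (hd.hc_nonneg v))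
    _ = _ := by ring

lemma c_int (hd : Distinguished f g B l ι c) : Integrable c := by
  have := ((hd.hc_suff ν LinearMap.id Function.injective_id).1 0).2
  simpa using this

lemma DJ_mono {σ : Fin m → ℝ} {J J' : Finset (Fin m)} (h : J' ⊆ J) :
    DJ B l σ J ⊆ DJ B l σ J' := fun _ hx => ⟨hx.1, fun j hj => hx.2 j (h hj)⟩

lemma hJ_int (hd : Distinguished f g B l ι c) (σ : Fin m → ℝ) (J : Finset (Fin m))
    {z : Fin n → ℂ} (hz : z ∈ tube (DJ B l σ J)) :
    Integrable (fun v => hJ g l J (addI z (ι v))) :=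
  int_aux (DJ_open hd.hB_open σ J) (hJ_diff hd σ J) (hJ_dom hd σ J) (c_int hd) hz

lemma lR_sum {T : Type*} (S : Finset T) (r : T → ℝ) (b : T → Fin n → ℝ) (x : Fin n → ℝ) :
    lR (∑ j ∈ S, r j • b j) x = ∑ j ∈ S, r j * lR (b j) x := by
  simp only [lR, Finset.sum_apply, Pi.smul_apply, smul_eq_mul, Finset.sum_mul, Finset.mul_sum]
  rw [Finset.sum_comm]
  exact Finset.sum_congr rfl fun _ _ => Finset.sum_congr rfl fun _ _ => by ring

lemma lC_sum {T : Type*} (S : Finset T) (r : T → ℝ) (b : T → Fin n → ℝ) (x : Fin n → ℂ) :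
    lC (∑ j ∈ S, r j • b j) x = ∑ j ∈ S, (r j : ℂ) * lC (b j) x := by
  simp only [lC, Finset.sum_apply, Pi.smul_apply, smul_eq_mul, Finset.sum_mul, Finset.mul_sum,
    Complex.ofReal_sum, Complex.ofReal_mul]
  rw [Finset.sum_comm]
  exact Finset.sum_congr rfl fun _ _ => Finset.sum_congr rfl fun _ _ => by ring

lemma lR_iota (a : Fin n → ℝ) (w : Fin ν → ℝ) :
    lR a (ι w) = ∑ k, lR a (ι (Pi.single k 1)) * w k := by
  let φ : (Fin n → ℝ) →ₗ[ℝ] ℝ :=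
    { toFun := lR a, map_add' := lR_add a, map_smul' := fun t x => lR_smul a x t }
  have h : φ (ι w) = ∑ k, φ (ι (Pi.single k 1)) * w k := by
    conv_lhs => rw [pi_eq_sum_univ' w, map_sum, map_sum]
    simp [mul_comm]
  exact h

lemma main_J (hd : Distinguished f g B l ι c) (σ : Fin m → ℝ) {C : Set (Fin n → ℝ)}
    (J : Finset (Fin m)) (hC : C ⊆ DJ B l σ J) :
    HolExt ι C (fun z => ∫ v, hJ g l J (addI z (ι v))) := by
  classical
  induction J using Finset.strongInduction with
  | H J ih =>
  have hCt : ∀ z ∈ tube C, z ∈ tube (DJ B l σ J) := fun z hz => hC hz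
  rcases gordan J (fun j k => σ j * lR (l j) (ι (Pi.single k 1))) with ⟨w, hw⟩ | ⟨r, hr, ⟨j₀, hj₀, hr₀⟩, hs⟩
  · have hw' : ∀ j ∈ J, 0 < σ j * lR (l j) (ι w) := by
      intro j hj
      have := hw j hj
      rw [lR_iota, Finset.mul_sum]
      simpa [mul_assoc] using this
    have hev : ∀ᶠ t : ℝ in nhds 0, t • ι w ∈ B := by
      have hc : Continuous (fun t : ℝ => t • ι w) := by fun_prop
      exact (hd.hB_open.preimage hc).mem_nhds (by simpa using hd.hB_zero)
    obtain ⟨t, htB, ht⟩ := ((hev.filter_mono (nhdsWithin_le_nhds (s := Set.Ioi 0))).and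
      self_mem_nhdsWithin).exists
    have ht' : 0 < t := ht
    obtain ⟨B', h1, h2, h3, h4, G, hG, hG'⟩ := extend_aux (DJ_open hd.hB_open σ J)
      (DJ_convex hd.hB_convex σ J)
      (diff_aux (DJ_open hd.hB_open σ J) (hJ_diff hd σ J) (hJ_dom hd σ J) (c_int hd)) (ι w)
      (fun z y => by
        rw [← map_smul]; exact shiftI_aux z (y • w)) t
      ⟨htB, fun j hj => by
        rw [lR_smul]
        have := mul_pos ht' (hw' j hj)
        linarith⟩
    exact ⟨B', h1, h2, h3, hC.trans h4, [], by simp, G, hG, fun z hz => by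
      simpa using hG' z (hCt z hz)⟩
  · have hvan : ∀ w, lR (∑ j ∈ J, (r j * σ j) • l j) (ι w) = 0 := by
      intro w
      rw [lR_iota]
      refine Finset.sum_eq_zero fun k _ => ?_
      have := congrFun hs k
      simp only [Finset.sum_apply, Pi.smul_apply, smul_eq_mul, Pi.zero_apply] at this
      rw [lR_sum]
      simp only [mul_assoc]
      rw [this, zero_mul]
    refine HolExt.of_mul hvan ?_ ?_
    · intro x hx
      rw [lR_sum]
      refine ne_of_gt (Finset.sum_pos' (fun j hj => ?_) ⟨j₀, hj₀, ?_⟩)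
      · rw [mul_assoc]; exact mul_nonneg (hr j hj) ((hC hx).2 j hj).le
      · rw [mul_assoc]; exact mul_pos hr₀ ((hC hx).2 j₀ hj₀)
    · have hE := HolExt.sum J (fun j z => ((r j * σ j : ℝ) : ℂ) * ∫ v, hJ g l (J.erase j) (addI z (ι v)))
        (fun j hj => (ih (J.erase j) (Finset.erase_ssubset hj)
          (hC.trans (DJ_mono (Finset.erase_subset _ _)))).smul _)
      refine hE.congr fun z hz => ?_
      have hzJ := hCt z hz
      have hpt : ∀ v, lC (∑ j ∈ J, (r j * σ j) • l j) z * hJ g l J (addI z (ι v)) =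
          ∑ j ∈ J, ((r j * σ j : ℝ) : ℂ) * hJ g l (J.erase j) (addI z (ι v)) := by
        intro v
        have e : lC (∑ j ∈ J, (r j * σ j) • l j) z =
            lC (∑ j ∈ J, (r j * σ j) • l j) (addI z (ι v)) := by
          rw [lC_addI, hvan]; simp
        rw [e, lC_sum, Finset.sum_mul]
        refine Finset.sum_congr rfl fun j hj => ?_
        have hne : lC (l j) (addI z (ι v)) ≠ 0 := lC_ne ((addI_mem_tube _).2 hzJ) hj
        unfold hJ
        rw [← Finset.mul_prod_erase J _ hj]
        field_simp
      rw [← integral_const_mul]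
      simp_rw [hpt]
      rw [integral_finsetSum]
      · simp_rw [integral_const_mul]
      · intro j hj
        exact (hJ_int hd σ (J.erase j) (DJ_mono (Finset.erase_subset _ _) hzJ)).const_mul _

lemma comp_sub {C : Set (Fin n → ℝ)} {x₀ : Fin n → ℝ}
    (hx₀ : x₀ ∈ B \ ⋃ j, {x | lR (l j) x = 0})
    (hC : C = connectedComponentIn (B \ ⋃ j, {x | lR (l j) x = 0}) x₀) (J : Finset (Fin m)) :
    C ⊆ DJ B l (fun j => lR (l j) x₀) J := by
  intro x hx
  have hsub : C ⊆ B \ ⋃ j, {x | lR (l j) x = 0} := hC ▸ connectedComponentIn_subset _ _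
  have hne : ∀ y ∈ C, ∀ j, lR (l j) y ≠ 0 := fun y hy j h0 =>
    (hsub hy).2 (Set.mem_iUnion.2 ⟨j, h0⟩)
  have hx₀C : x₀ ∈ C := hC ▸ mem_connectedComponentIn hx₀
  have hpre : IsPreconnected C := hC ▸ isPreconnected_connectedComponentIn
  refine ⟨(hsub hx).1, fun j _ => ?_⟩
  by_contra hcon
  push Not at hcon
  have hc : ContinuousOn (fun y => lR (l j) x₀ * lR (l j) y) C :=
    (continuous_const.mul (lR_continuous _)).continuousOn
  obtain ⟨y, hy, hy0⟩ := hpre.intermediate_value hx hx₀C hc ⟨hcon, mul_self_nonneg _⟩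
  rcases mul_eq_zero.1 hy0 with h | h
  · exact hne _ hx₀C j h
  · exact hne _ hy j h

end

theorem statement2 {n ν m : ℕ} (f g : (Fin n → ℂ) → ℂ)
    (B : Set (Fin n → ℝ)) (l : Fin m → (Fin n → ℝ))
    (ι : (Fin ν → ℝ) →ₗ[ℝ] (Fin n → ℝ)) (c : (Fin ν → ℝ) → ℝ)
    (hdist : Distinguished f g B l ι c)
    -- `C` is a connected component of `B \ ∪_j ker l_j`
    (C : Set (Fin n → ℝ))
    (hC : ∃ x₀ ∈ B \ ⋃ j, {x | lR (l j) x = 0},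
      C = connectedComponentIn (B \ ⋃ j, {x | lR (l j) x = 0}) x₀) :
    -- there is an open convex neighborhood `B̃` of `0` containing `C` ...
    ∃ Btil : Set (Fin n → ℝ), IsOpen Btil ∧ Convex ℝ Btil ∧
      (0 : Fin n → ℝ) ∈ Btil ∧ C ⊆ Btil ∧
      -- ... and real linear forms `l̃_1, …, l̃_m̃` ...
      ∃ (mtil : ℕ) (ltil : Fin mtil → (Fin n → ℝ)),
        -- ... each vanishing identically on `V` ...
        (∀ j, ∀ w : Fin ν → ℝ, lR (ltil j) (ι w) = 0) ∧
        -- ... with `ker(l̃_j) ∩ C = ∅` for each `j` ...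
        (∀ j, ∀ x ∈ C, lR (ltil j) x ≠ 0) ∧
        -- ... such that `f̃_C(z) ∏_j l̃_j(z)` continues holomorphically to `𝒯_B̃`
        ∃ G : (Fin n → ℂ) → ℂ, DifferentiableOn ℂ G (tube Btil) ∧
          ∀ z ∈ tube C, G z = ftil f ι z * ∏ j, lC (ltil j) z := by
  classical
  obtain ⟨x₀, hx₀, hCe⟩ := hC
  set σ : Fin m → ℝ := fun j => lR (l j) x₀
  have hsub := fun J => comp_sub hx₀ hCe J
  have hE : HolExt ι C (ftil f ι) := by
    have h1 := (HolExt.sum Finset.univ.powerset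
      (fun J z => ∫ v, hJ g l J (addI z (ι v)))
      (fun J _ => main_J hdist σ J (hsub J))).smul (((2 * Real.pi : ℂ) ^ ν)⁻¹)
    refine h1.congr fun z hz => ?_
    have hzU : ∀ J, z ∈ tube (DJ B l σ J) := fun J => hsub J hz
    unfold ftil
    congr 1
    rw [← integral_finsetSum _ fun J _ => hJ_int hdist σ J (hzU J)]
    congr 1
    ext v
    have hzv : addI z (ι v) ∈ tube (DJ B l σ Finset.univ) := (addI_mem_tube _).2 (hzU _)
    have hne : ∀ j, lC (l j) (addI z (ι v)) ≠ 0 := fun j => lC_ne hzv (Finset.mem_univ j)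
    have hne1 : ∀ j, lC (l j) (addI z (ι v)) + 1 ≠ 0 := by
      intro j h0
      have h1 := hdist.hB_l _ hzv.1 j
      rw [← lC_re, eq_neg_of_add_eq_zero_left h0] at h1
      simp at h1
    unfold hJ
    rw [← Finset.mul_sum, ← Finset.prod_one_add, hdist.hfg _ hzv.1 hne, mul_assoc,
      ← Finset.prod_mul_distrib, Finset.prod_eq_one, mul_one]
    intro j _
    have a := hne j
    have b := hne1 j
    field_simp
  obtain ⟨B', h1, h2, h3, h4, L, hL, G, hG, hG'⟩ := hE
  refine ⟨B', h1, h2, h3, h4, L.length, L.get, fun j w => (hL _ (L.get_mem j)).1 w,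
    fun j x hx => (hL _ (L.get_mem j)).2 x hx, G, hG, fun z hz => ?_⟩
  rw [hG' z hz]
  congr 1
  rw [← List.prod_ofFn]
  congr 1
  exact (List.ofFn_getElem_eq_map L (fun a => lC a z)).symm
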